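/- arXiv:1508.06807 — 2 statements merged into one kernel-verified Lean document; each statement's English description precedes it below -/
import Mathlib

section
/- Let a ∈ ℝ and let u, ρ : ℝ×ℝ → ℝ be smooth functions satisfying ρ_t = −u ρ_x − (a−1) u_x ρ. Let φ : ℝ×ℝ → ℝ be smooth with ∂_t φ(t,x) = u(t, φ(t,x)) and ∂_x φ(t,x) > 0 for all (t,x). Then for every x ∈ ℝ, the function t ↦ ρ(t, φ(t,x)) · (∂_x φ(t,x))^{a−1} is constant in t; equivalently, ρ(t, φ(t,x)) · (∂_x φ(t,x))^{a−1} = ρ(0, φ(0,x)) · (∂_x φ(0,x))^{a−1} for all t. -/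
open Real

section PartialDerivatives

variable {E : Type*} [NormedAddCommGroup E] [NormedSpace ℝ E] {f : ℝ → ℝ → ℝ}

theorem hasDerivAt_comp_prodMk_left {F : ℝ × ℝ → E} (hF : Differentiable ℝ F) (t x : ℝ) :
    HasDerivAt (fun τ => F (τ, x)) (fderiv ℝ F (t, x) (1, 0)) t := by
  have h : HasDerivAt (fun τ : ℝ => (τ, x)) ((1, 0) : ℝ × ℝ) t :=
    (hasDerivAt_id' t).prodMk (hasDerivAt_const t x)
  exact HasFDerivAt.comp_hasDerivAt (l := F) t (hF (t, x)).hasFDerivAt h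

theorem hasDerivAt_comp_prodMk_right {F : ℝ × ℝ → E} (hF : Differentiable ℝ F) (t x : ℝ) :
    HasDerivAt (fun y => F (t, y)) (fderiv ℝ F (t, x) (0, 1)) x := by
  have h : HasDerivAt (fun y : ℝ => (t, y)) ((0, 1) : ℝ × ℝ) x :=
    (hasDerivAt_const x t).prodMk (hasDerivAt_id' x)
  exact HasFDerivAt.comp_hasDerivAt (l := F) x (hF (t, x)).hasFDerivAt h

theorem hasDerivAt_partial_fst (hf : Differentiable ℝ (Function.uncurry f)) (t x : ℝ) :
    HasDerivAt (fun τ => f τ x) (fderiv ℝ (Function.uncurry f) (t, x) (1, 0)) t :=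
  hasDerivAt_comp_prodMk_left hf t x

theorem hasDerivAt_partial_snd (hf : Differentiable ℝ (Function.uncurry f)) (t x : ℝ) :
    HasDerivAt (f t) (fderiv ℝ (Function.uncurry f) (t, x) (0, 1)) x :=
  hasDerivAt_comp_prodMk_right hf t x

/-- The chain rule for a function of two variables along a graph. -/
theorem hasDerivAt_along_graph (hf : Differentiable ℝ (Function.uncurry f)) {c : ℝ → ℝ}
    {c' t : ℝ} (hc : HasDerivAt c c' t) :
    HasDerivAt (fun τ => f τ (c τ))
      (deriv (fun τ => f τ (c t)) t + c' * deriv (f t) (c t)) t := by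
  have h : HasDerivAt (fun τ => f τ (c τ))
      (fderiv ℝ (Function.uncurry f) (t, c t) (1, c')) t := by
    have hg : HasDerivAt (fun τ => (τ, c τ)) ((1, c') : ℝ × ℝ) t :=
      (hasDerivAt_id' t).prodMk hc
    exact HasFDerivAt.comp_hasDerivAt (l := Function.uncurry f) t
      (hf (t, c t)).hasFDerivAt hg
  have hv : ((1, c') : ℝ × ℝ) = (1, 0) + c' • (0, 1) := by simp
  rwa [hv, map_add, map_smul, ← (hasDerivAt_partial_fst hf t (c t)).deriv,
    ← (hasDerivAt_partial_snd hf t (c t)).deriv, smul_eq_mul] at h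

/-- Mixed partial derivatives of a `C²` function commute. -/
theorem hasDerivAt_deriv_snd (hf : ContDiff ℝ 2 (Function.uncurry f)) (t x : ℝ) :
    HasDerivAt (fun τ => deriv (f τ) x)
      (deriv (fun y => deriv (fun τ => f τ y) t) x) t := by
  have hd : Differentiable ℝ (Function.uncurry f) := hf.differentiable (by norm_num)
  have hd' : Differentiable ℝ (fderiv ℝ (Function.uncurry f)) :=
    (hf.fderiv_right (m := 1) (by norm_num)).differentiable (by norm_num)
  have hsymm : IsSymmSndFDerivAt ℝ (Function.uncurry f) (t, x) :=
    hf.contDiffAt.isSymmSndFDerivAt (by simp)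
  have h₁ := (hasDerivAt_comp_prodMk_left hd' t x).clm_apply
    (hasDerivAt_const t ((0, 1) : ℝ × ℝ))
  have h₂ := (hasDerivAt_comp_prodMk_right hd' t x).clm_apply
    (hasDerivAt_const x ((1, 0) : ℝ × ℝ))
  simp only [map_zero, add_zero] at h₁ h₂
  have e₁ : (fun τ => deriv (f τ) x)
      = fun τ => fderiv ℝ (Function.uncurry f) (τ, x) (0, 1) :=
    funext fun τ => (hasDerivAt_partial_snd hd τ x).deriv
  have e₂ : (fun y => deriv (fun τ => f τ y) t)
      = fun y => fderiv ℝ (Function.uncurry f) (t, y) (1, 0) :=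
    funext fun y => (hasDerivAt_partial_fst hd t y).deriv
  rw [e₁, e₂, HasDerivAt.deriv h₂, ← hsymm.eq]
  exact h₁

end PartialDerivatives

theorem rho_phi_pow_conserved (a : ℝ) (u ρ : ℝ → ℝ → ℝ) (φ : ℝ → ℝ → ℝ)
    (hu : ContDiff ℝ (⊤ : ℕ∞) (Function.uncurry u)) (hρ : ContDiff ℝ (⊤ : ℕ∞) (Function.uncurry ρ))
    (hφ : ContDiff ℝ (⊤ : ℕ∞) (Function.uncurry φ))
    (hρt : ∀ t x, deriv (fun τ => ρ τ x) t
      = -(u t x) * deriv (ρ t) x - (a - 1) * deriv (u t) x * ρ t x)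
    (hflow : ∀ t x, deriv (fun τ => φ τ x) t = u t (φ t x))
    (hφx : ∀ t x, 0 < deriv (φ t) x) :
    ∀ x t : ℝ,
      ρ t (φ t x) * (deriv (φ t) x) ^ (a - 1)
        = ρ 0 (φ 0 x) * (deriv (φ 0) x) ^ (a - 1) := by
  intro x t
  have hρd : Differentiable ℝ (Function.uncurry ρ) := hρ.differentiable (by simp)
  have hud : Differentiable ℝ (Function.uncurry u) := hu.differentiable (by simp)
  have hφd : Differentiable ℝ (Function.uncurry φ) := hφ.differentiable (by simp)
  have key : ∀ s, HasDerivAt (fun τ => ρ τ (φ τ x) * deriv (φ τ) x ^ (a - 1)) 0 s := by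
    intro s
    have hφs : HasDerivAt (fun τ => φ τ x) (u s (φ s x)) s := by
      rw [← hflow s x]
      exact (hasDerivAt_partial_fst hφd s x).differentiableAt.hasDerivAt
    have hJ : HasDerivAt (fun τ => deriv (φ τ) x)
        (deriv (u s) (φ s x) * deriv (φ s) x) s := by
      have h := hasDerivAt_deriv_snd (hφ.of_le (WithTop.coe_le_coe.2 le_top)) s x
      simp only [hflow] at h
      have hcomp : HasDerivAt (fun y => u s (φ s y))
          (deriv (u s) (φ s x) * deriv (φ s) x) x :=
        (hasDerivAt_partial_snd hud s (φ s x)).differentiableAt.hasDerivAt.comp x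
          (hasDerivAt_partial_snd hφd s x).differentiableAt.hasDerivAt
      rwa [hcomp.deriv] at h
    have hne : deriv (φ s) x ≠ 0 := (hφx s x).ne'
    refine ((hasDerivAt_along_graph hρd hφs).mul
      (hJ.rpow_const (p := a - 1) (Or.inl hne))).congr_deriv ?_
    have hpow : deriv (φ s) x ^ (a - 1) = deriv (φ s) x * deriv (φ s) x ^ (a - 1 - 1) := by
      rw [rpow_sub_one hne (a - 1), mul_div_cancel₀ _ hne]
    rw [hρt, hpow]
    ring
  exact is_const_of_deriv_eq_zero (fun s => (key s).differentiableAt)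
    (fun s => (key s).deriv) t 0
end

section
/- Let a, α, κ ∈ ℝ and let u, ρ, m : ℝ×ℝ → ℝ be smooth functions, 1-periodic in the second (spatial) variable x, satisfying m_t = α u_x − a u_x m − u m_x − κ ρ ρ_x and ρ_t = −u ρ_x − (a−1) u_x ρ. Suppose there is C₀ > 0 such that for all t ∈ ℝ: ‖u(t,·)‖_{H²} ≤ C₀ ‖m(t,·)‖_{L²}, ‖u_x(t,·)‖_∞ ≤ C₀ ‖m(t,·)‖_{L²}, and ‖u(t,·)‖_{H³} ≤ C₀ ‖m(t,·)‖_{H¹}. Then there exists C > 0 such that for all t ∈ ℝ: d/dt ( ‖m(t,·)‖_{H¹}² + ‖ρ(t,·)‖_{H²}² ) ≤ C ( ‖m(t,·)‖_{L²}² + (1 + ‖m(t,·)‖_{L²} + ‖ρ(t,·)‖_{H¹}) ( ‖m(t,·)‖_{H¹}² + ‖ρ(t,·)‖_{H²}² ) ). -/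
open MeasureTheory Real

/-- Squared `L²(0,1)`-norm of a (`1`-periodic) function. -/
noncomputable def L2Sq (f : ℝ → ℝ) : ℝ := ∫ x in (0:ℝ)..1, (f x) ^ 2

/-- Squared Sobolev `Hⁿ`-norm: `‖f‖_{Hⁿ}² = ∑_{j=0}^n ∫₀¹ (f⁽ʲ⁾)²`. -/
noncomputable def HSq (n : ℕ) (f : ℝ → ℝ) : ℝ :=
  ∑ j ∈ Finset.range (n + 1), ∫ x in (0:ℝ)..1, (iteratedDeriv j f x) ^ 2

/-- Sobolev `Hⁿ`-norm. -/
noncomputable def HNorm (n : ℕ) (f : ℝ → ℝ) : ℝ := Real.sqrt (HSq n f)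

/-- Sup-norm `‖f‖_∞ = sup_x |f x|`. -/
noncomputable def supNorm (f : ℝ → ℝ) : ℝ := ⨆ x : ℝ, |f x|

/-- Partial derivative in the second variable. -/
noncomputable def spaceDeriv (f : ℝ → ℝ → ℝ) : ℝ → ℝ → ℝ := fun t => deriv (f t)

/-- Partial derivative in the first variable. -/
noncomputable def timeDeriv (f : ℝ → ℝ → ℝ) : ℝ → ℝ → ℝ := fun t x => deriv (fun τ => f τ x) t

/-- Joint smoothness of a function of time and space. -/
def JointlySmooth (f : ℝ → ℝ → ℝ) : Prop := ContDiff ℝ (⊤ : ℕ∞) (Function.uncurry f)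

namespace JointlySmooth

variable {f g : ℝ → ℝ → ℝ}

theorem hasDerivAt_space_fderiv (hf : JointlySmooth f) (t x : ℝ) :
    HasDerivAt (f t) (fderiv ℝ (Function.uncurry f) (t, x) (0, 1)) x :=
  ((hf.differentiable (by simp)) (t, x)).hasFDerivAt.comp_hasDerivAt x
    ((hasDerivAt_const x t).prodMk (hasDerivAt_id x))

theorem hasDerivAt_time_fderiv (hf : JointlySmooth f) (t x : ℝ) :
    HasDerivAt (fun τ => f τ x) (fderiv ℝ (Function.uncurry f) (t, x) (1, 0)) t :=
  ((hf.differentiable (by simp)) (t, x)).hasFDerivAt.comp_hasDerivAt (f := fun τ => (τ, x)) t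
    ((hasDerivAt_id t).prodMk (hasDerivAt_const t x))

theorem hasDerivAt_space (hf : JointlySmooth f) (t x : ℝ) :
    HasDerivAt (f t) (spaceDeriv f t x) x :=
  (hf.hasDerivAt_space_fderiv t x).differentiableAt.hasDerivAt

theorem hasDerivAt_time (hf : JointlySmooth f) (t x : ℝ) :
    HasDerivAt (fun τ => f τ x) (timeDeriv f t x) t :=
  (hf.hasDerivAt_time_fderiv t x).differentiableAt.hasDerivAt

theorem uncurry_spaceDeriv (hf : JointlySmooth f) :
    Function.uncurry (spaceDeriv f) = fun p => fderiv ℝ (Function.uncurry f) p (0, 1) := by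
  ext ⟨t, x⟩
  exact (hf.hasDerivAt_space_fderiv t x).deriv

theorem uncurry_timeDeriv (hf : JointlySmooth f) :
    Function.uncurry (timeDeriv f) = fun p => fderiv ℝ (Function.uncurry f) p (1, 0) := by
  ext ⟨t, x⟩
  exact (hf.hasDerivAt_time_fderiv t x).deriv

theorem contDiff_fderiv (hf : JointlySmooth f) :
    ContDiff ℝ (⊤ : ℕ∞) (fderiv ℝ (Function.uncurry f)) :=
  ContDiff.fderiv_right hf (by simp)

theorem spaceDeriv (hf : JointlySmooth f) : JointlySmooth (spaceDeriv f) := by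
  rw [JointlySmooth, hf.uncurry_spaceDeriv]
  exact hf.contDiff_fderiv.clm_apply contDiff_const

theorem timeDeriv (hf : JointlySmooth f) : JointlySmooth (timeDeriv f) := by
  rw [JointlySmooth, hf.uncurry_timeDeriv]
  exact hf.contDiff_fderiv.clm_apply contDiff_const

theorem continuous (hf : JointlySmooth f) (t : ℝ) : Continuous (f t) :=
  (ContDiff.continuous hf).comp (by fun_prop : Continuous fun x : ℝ => (t, x))

/-- Partial derivatives in time and space commute. -/
theorem timeDeriv_spaceDeriv (hf : JointlySmooth f) :
    _root_.timeDeriv (_root_.spaceDeriv f) = _root_.spaceDeriv (_root_.timeDeriv f) := by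
  ext t x
  have hd : HasFDerivAt (fderiv ℝ (Function.uncurry f))
      (fderiv ℝ (fderiv ℝ (Function.uncurry f)) (t, x)) (t, x) :=
    (hf.contDiff_fderiv.differentiable (by simp) _).hasFDerivAt
  have h1 := hf.spaceDeriv.hasDerivAt_time_fderiv t x
  have h2 := hf.timeDeriv.hasDerivAt_space_fderiv t x
  rw [hf.uncurry_spaceDeriv, (hd.clm_apply (hasFDerivAt_const _ _)).fderiv] at h1
  rw [hf.uncurry_timeDeriv, (hd.clm_apply (hasFDerivAt_const _ _)).fderiv] at h2
  have hsymm : IsSymmSndFDerivAt ℝ (Function.uncurry f) (t, x) :=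
    (ContDiff.contDiffAt hf).isSymmSndFDerivAt (by
      rw [minSmoothness_of_isRCLikeNormedField]
      exact WithTop.coe_le_coe.2 le_top)
  refine h1.deriv.trans (Eq.trans ?_ h2.deriv.symm)
  simpa using hsymm (1, 0) (0, 1)

/-- Differentiation of the squared `L²`-norm under the integral sign. -/
theorem hasDerivAt_L2Sq (hf : JointlySmooth f) (t : ℝ) :
    HasDerivAt (fun τ => L2Sq (f τ)) (∫ x in (0:ℝ)..1, 2 * f t x * _root_.timeDeriv f t x) t := by
  have hcont : Continuous fun p : ℝ × ℝ => 2 * f p.1 p.2 * _root_.timeDeriv f p.1 p.2 :=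
    (continuous_const.mul (ContDiff.continuous hf)).mul (ContDiff.continuous hf.timeDeriv)
  obtain ⟨B, hB⟩ := ((isCompact_closedBall t 1).prod (isCompact_Icc (a := (0:ℝ)) (b := 1))
    ).exists_bound_of_continuousOn hcont.continuousOn
  refine (intervalIntegral.hasDerivAt_integral_of_dominated_loc_of_deriv_le
    (F' := fun τ x => 2 * f τ x * _root_.timeDeriv f τ x) (bound := fun _ => B)
    (Metric.closedBall_mem_nhds t one_pos) (.of_forall fun τ => ?_) ?_ ?_ ?_ (by simp) ?_).2
  · exact ((hf.continuous τ).pow 2).aestronglyMeasurable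
  · exact ((hf.continuous t).pow 2).intervalIntegrable _ _
  · exact ((continuous_const.mul (hf.continuous t)).mul
      (hf.timeDeriv.continuous t)).aestronglyMeasurable
  · refine .of_forall fun x hx τ hτ => hB (τ, x) ⟨hτ, ?_⟩
    rw [Set.uIoc_of_le zero_le_one] at hx
    exact Set.Ioc_subset_Icc_self hx
  · refine .of_forall fun x _ τ _ => ?_
    simpa using! (hf.hasDerivAt_time τ x).pow 2

end JointlySmooth

theorem L2Sq_nonneg (f : ℝ → ℝ) : 0 ≤ L2Sq f :=
  intervalIntegral.integral_nonneg zero_le_one fun _ _ => sq_nonneg _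

/-- The Cauchy–Schwarz inequality on the unit interval. -/
theorem integral_abs_mul_le {f g : ℝ → ℝ} (hf : Continuous f) (hg : Continuous g) :
    ∫ x in (0:ℝ)..1, |f x| * |g x| ≤ √(L2Sq f) * √(L2Sq g) := by
  have key (s : ℝ) : 0 ≤ L2Sq f * (s * s) + (2 * ∫ x in (0:ℝ)..1, |f x| * |g x|) * s + L2Sq g := by
    have h : ∫ x in (0:ℝ)..1, (s * |f x| + |g x|) ^ 2
        = L2Sq f * (s * s) + (2 * ∫ x in (0:ℝ)..1, |f x| * |g x|) * s + L2Sq g := by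
      have e : ∀ x, (s * |f x| + |g x|) ^ 2
          = s * s * f x ^ 2 + 2 * s * (|f x| * |g x|) + g x ^ 2 := fun x => by
        rw [← sq_abs (f x), ← sq_abs (g x)]; ring
      simp_rw [e]
      rw [intervalIntegral.integral_add, intervalIntegral.integral_add,
        intervalIntegral.integral_const_mul, intervalIntegral.integral_const_mul, L2Sq, L2Sq]
      · ring
      all_goals exact Continuous.intervalIntegrable (by fun_prop) _ _
    rw [← h]
    exact intervalIntegral.integral_nonneg zero_le_one fun _ _ => sq_nonneg _
  have hd := discrim_le_zero key
  rw [discrim] at hd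
  rw [← Real.sqrt_mul (L2Sq_nonneg f)]
  exact Real.le_sqrt_of_sq_le (by linarith)

theorem integral_abs_le {f : ℝ → ℝ} (hf : Continuous f) :
    ∫ x in (0:ℝ)..1, |f x| ≤ √(L2Sq f) := by
  simpa [L2Sq] using integral_abs_mul_le hf (continuous_const (y := (1:ℝ)))

/-- The Sobolev embedding `H¹ ⊂ L^∞` on the unit interval. -/
theorem abs_le_sqrt_L2Sq_add {f f' : ℝ → ℝ} (hf : ∀ x, HasDerivAt f (f' x) x)
    (hf' : Continuous f') {x : ℝ} (hx : x ∈ Set.Icc (0:ℝ) 1) :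
    |f x| ≤ √(L2Sq f) + √(L2Sq f') := by
  have hc : Continuous f := continuous_iff_continuousAt.2 fun y => (hf y).continuousAt
  have hpt : ∀ y ∈ Set.Icc (0:ℝ) 1, |f x| ≤ |f y| + ∫ z in (0:ℝ)..1, |f' z| := fun y hy => by
    have h1 : ∫ z in y..x, f' z = f x - f y :=
      intervalIntegral.integral_eq_sub_of_hasDerivAt (fun z _ => hf z) (hf'.intervalIntegrable _ _)
    have h2 : |∫ z in y..x, f' z| ≤ ∫ z in (0:ℝ)..1, |f' z| := by
      refine (intervalIntegral.norm_integral_le_integral_norm_uIoc (f := f')).trans ?_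
      rw [intervalIntegral.integral_of_le zero_le_one]
      refine setIntegral_mono_set ?_ (.of_forall fun _ => abs_nonneg _)
        (Set.Ioc_subset_Ioc (le_min hy.1 hx.1) (max_le hy.2 hx.2)).eventuallyLE
      exact (hf'.abs.intervalIntegrable 0 1).1
    have h3 : |f x| ≤ |f y| + |f x - f y| := by
      simpa using abs_add_le (f y) (f x - f y)
    rw [h1] at h2
    linarith
  have h := intervalIntegral.integral_mono_on (μ := volume) zero_le_one
    (continuous_const.intervalIntegrable _ _)
    (Continuous.intervalIntegrable (by fun_prop) _ _) hpt
  rw [intervalIntegral.integral_add (hc.abs.intervalIntegrable _ _)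
    (continuous_const.intervalIntegrable _ _)] at h
  simp only [intervalIntegral.integral_const, sub_zero, one_smul] at h
  linarith [integral_abs_le hc, integral_abs_le hf']

theorem HSq_one (f : ℝ → ℝ) : HSq 1 f = L2Sq f + L2Sq (deriv f) := by
  simp [HSq, L2Sq, Finset.sum_range_succ]

theorem HSq_two (f : ℝ → ℝ) : HSq 2 f = HSq 1 f + L2Sq (deriv (deriv f)) := by
  simp [HSq, L2Sq, Finset.sum_range_succ, iteratedDeriv_succ]

theorem HSq_three (f : ℝ → ℝ) : HSq 3 f = HSq 2 f + L2Sq (deriv (deriv (deriv f))) := by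
  simp [HSq, L2Sq, Finset.sum_range_succ, iteratedDeriv_succ]

/-- The spatial mean of `F` is bounded by a constant multiple of `w`, uniformly in time. -/
def MeanControlled (w : ℝ → ℝ) (F : ℝ → ℝ → ℝ) : Prop :=
  (∀ t, Continuous (F t)) ∧ ∃ C, ∀ t, |∫ x in (0:ℝ)..1, F t x| ≤ C * w t

/-- The supremum of `|f|` over the unit interval is bounded by a constant multiple of `w`,
uniformly in time. -/
def SupControlled (w : ℝ → ℝ) (f : ℝ → ℝ → ℝ) : Prop :=
  ∃ C, ∀ t, ∀ x ∈ Set.Icc (0:ℝ) 1, |f t x| ≤ C * w t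

/-- The spatial `L²`-norm of `f` is bounded by a constant multiple of `w`, uniformly in time. -/
def L2Controlled (w : ℝ → ℝ) (f : ℝ → ℝ → ℝ) : Prop :=
  ∃ C, ∀ t, √(L2Sq (f t)) ≤ C * w t

section Controlled

variable {w w₁ w₂ w₃ : ℝ → ℝ} {f g h F G : ℝ → ℝ → ℝ}

theorem MeanControlled.add (hF : MeanControlled w F) (hG : MeanControlled w G) :
    MeanControlled w (fun t x => F t x + G t x) := by
  obtain ⟨hFc, A, hA⟩ := hF
  obtain ⟨hGc, B, hB⟩ := hG
  refine ⟨fun t => (hFc t).add (hGc t), A + B, fun t => ?_⟩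
  rw [intervalIntegral.integral_add ((hFc t).intervalIntegrable _ _)
    ((hGc t).intervalIntegrable _ _), add_mul]
  exact (abs_add_le _ _).trans (add_le_add (hA t) (hB t))

theorem MeanControlled.const_mul (c : ℝ) (hF : MeanControlled w F) :
    MeanControlled w (fun t x => c * F t x) := by
  obtain ⟨hFc, A, hA⟩ := hF
  refine ⟨fun t => continuous_const.mul (hFc t), |c| * A, fun t => ?_⟩
  rw [intervalIntegral.integral_const_mul, abs_mul, mul_assoc]
  exact mul_le_mul_of_nonneg_left (hA t) (abs_nonneg c)

theorem MeanControlled.mono (hF : MeanControlled w₁ F) (hw₁ : ∀ t, 0 ≤ w₁ t)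
    (hw : ∀ t, w₁ t ≤ w₂ t) : MeanControlled w₂ F := by
  obtain ⟨hFc, A, hA⟩ := hF
  exact ⟨hFc, |A|, fun t => (hA t).trans <|
    mul_le_mul (le_abs_self A) (hw t) (hw₁ t) (abs_nonneg A)⟩

theorem SupControlled.of_L2 (hf : JointlySmooth f) (h₀ : L2Controlled w f)
    (h₁ : L2Controlled w (spaceDeriv f)) : SupControlled w f := by
  obtain ⟨A, hA⟩ := h₀
  obtain ⟨B, hB⟩ := h₁
  refine ⟨A + B, fun t x hx => ?_⟩
  rw [add_mul]
  exact (abs_le_sqrt_L2Sq_add (hf.hasDerivAt_space t) (hf.spaceDeriv.continuous t) hx).trans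
    (add_le_add (hA t) (hB t))

theorem MeanControlled.mul (hf : JointlySmooth f) (hg : JointlySmooth g)
    (hfw : L2Controlled w₁ f) (hgw : L2Controlled w₂ g) :
    MeanControlled (fun t => w₁ t * w₂ t) (fun t x => f t x * g t x) := by
  obtain ⟨A, hA⟩ := hfw
  obtain ⟨B, hB⟩ := hgw
  refine ⟨fun t => (hf.continuous t).mul (hg.continuous t), A * B, fun t => ?_⟩
  calc |∫ x in (0:ℝ)..1, f t x * g t x|
      ≤ ∫ x in (0:ℝ)..1, |f t x * g t x| :=
        intervalIntegral.abs_integral_le_integral_abs zero_le_one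
    _ = ∫ x in (0:ℝ)..1, |f t x| * |g t x| := by simp_rw [abs_mul]
    _ ≤ √(L2Sq (f t)) * √(L2Sq (g t)) := integral_abs_mul_le (hf.continuous t) (hg.continuous t)
    _ ≤ (A * w₁ t) * (B * w₂ t) :=
        mul_le_mul (hA t) (hB t) (Real.sqrt_nonneg _) ((Real.sqrt_nonneg _).trans (hA t))
    _ = A * B * (w₁ t * w₂ t) := by ring

theorem MeanControlled.mul_mul (hf : JointlySmooth f) (hg : JointlySmooth g)
    (hh : JointlySmooth h) (hfw : SupControlled w₁ f) (hgw : L2Controlled w₂ g)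
    (hhw : L2Controlled w₃ h) :
    MeanControlled (fun t => w₁ t * w₂ t * w₃ t) (fun t x => f t x * g t x * h t x) := by
  obtain ⟨S, hS⟩ := hfw
  obtain ⟨A, hA⟩ := hgw
  obtain ⟨B, hB⟩ := hhw
  have hfc := hf.continuous
  have hgc := hg.continuous
  have hhc := hh.continuous
  refine ⟨fun t => by fun_prop, S * A * B, fun t => ?_⟩
  have hS₀ : 0 ≤ S * w₁ t := (abs_nonneg _).trans (hS t 0 (by simp))
  calc |∫ x in (0:ℝ)..1, f t x * g t x * h t x|
      ≤ ∫ x in (0:ℝ)..1, |f t x * g t x * h t x| :=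
        intervalIntegral.abs_integral_le_integral_abs zero_le_one
    _ ≤ ∫ x in (0:ℝ)..1, S * w₁ t * (|g t x| * |h t x|) := by
        refine intervalIntegral.integral_mono_on zero_le_one
          (Continuous.intervalIntegrable (by fun_prop) _ _)
          (Continuous.intervalIntegrable (by fun_prop) _ _) fun x hx => ?_
        rw [abs_mul, abs_mul, mul_assoc]
        exact mul_le_mul_of_nonneg_right (hS t x hx) (by positivity)
    _ ≤ S * w₁ t * (√(L2Sq (g t)) * √(L2Sq (h t))) := by
        rw [intervalIntegral.integral_const_mul]
        exact mul_le_mul_of_nonneg_left (integral_abs_mul_le (hgc t) (hhc t)) hS₀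
    _ ≤ S * w₁ t * ((A * w₂ t) * (B * w₃ t)) := by
        refine mul_le_mul_of_nonneg_left ?_ hS₀
        exact mul_le_mul (hA t) (hB t) (Real.sqrt_nonneg _) ((Real.sqrt_nonneg _).trans (hA t))
    _ = S * A * B * (w₁ t * w₂ t * w₃ t) := by ring

/-- Integration by parts moves the derivative in a transport term onto the velocity. -/
theorem MeanControlled.transport (hf : JointlySmooth f) (hg : JointlySmooth g)
    (hfp : ∀ t, Function.Periodic (f t) 1) (hgp : ∀ t, Function.Periodic (g t) 1)
    (hfw : SupControlled w₁ (spaceDeriv f)) (hgw : L2Controlled w₂ g) :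
    MeanControlled (fun t => w₁ t * w₂ t * w₂ t)
      (fun t x => f t x * g t x * spaceDeriv g t x) := by
  have hfc := hf.continuous
  have hgc := hg.continuous
  have hfc' := hf.spaceDeriv.continuous
  have hgc' := hg.spaceDeriv.continuous
  obtain ⟨_, C, hC⟩ := (MeanControlled.mul_mul hf.spaceDeriv hg hg hfw hgw hgw).const_mul (-1 / 2)
  refine ⟨fun t => by fun_prop, C, fun t => ?_⟩
  have hparts : ∫ x in (0:ℝ)..1,
      (spaceDeriv f t x * g t x * g t x + 2 * (f t x * g t x * spaceDeriv g t x)) = 0 := by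
    rw [intervalIntegral.integral_eq_sub_of_hasDerivAt (f := fun x => f t x * g t x * g t x)
      (fun x _ => ?_) (Continuous.intervalIntegrable (by fun_prop) _ _)]
    · simp [(hfp t).eq, (hgp t).eq]
    · convert! ((hf.hasDerivAt_space t x).mul (hg.hasDerivAt_space t x)).mul
        (hg.hasDerivAt_space t x) using 1
      simp only [Pi.mul_apply]
      ring
  rw [intervalIntegral.integral_add (Continuous.intervalIntegrable (by fun_prop) _ _)
    (Continuous.intervalIntegrable (by fun_prop) _ _),
    intervalIntegral.integral_const_mul] at hparts
  convert hC t using 2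
  rw [intervalIntegral.integral_const_mul]
  linarith

end Controlled

theorem periodic_spaceDeriv {f : ℝ → ℝ → ℝ} (hf : ∀ t, Function.Periodic (f t) 1) (t : ℝ) :
    Function.Periodic (spaceDeriv f t) 1 := fun x => by
  rw [spaceDeriv, ← deriv_comp_add_const, funext (hf t)]

theorem energy_estimate_second (a α κ : ℝ)
    (u ρ m : ℝ → ℝ → ℝ)
    (hu : ContDiff ℝ (⊤ : ℕ∞) (Function.uncurry u)) (hρ : ContDiff ℝ (⊤ : ℕ∞) (Function.uncurry ρ))
    (hm : ContDiff ℝ (⊤ : ℕ∞) (Function.uncurry m))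
    (hup : ∀ t, Function.Periodic (u t) 1) (hρp : ∀ t, Function.Periodic (ρ t) 1)
    (hmp : ∀ t, Function.Periodic (m t) 1)
    (hmt : ∀ t x, deriv (fun τ => m τ x) t
      = α * deriv (u t) x - a * deriv (u t) x * m t x - u t x * deriv (m t) x
        - κ * ρ t x * deriv (ρ t) x)
    (hρt : ∀ t x, deriv (fun τ => ρ τ x) t
      = -(u t x) * deriv (ρ t) x - (a - 1) * deriv (u t) x * ρ t x)
    (C₀ : ℝ) (hC₀ : 0 < C₀)
    (hu2 : ∀ t : ℝ, HNorm 2 (u t) ≤ C₀ * Real.sqrt (L2Sq (m t)))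
    (hux : ∀ t : ℝ, supNorm (deriv (u t)) ≤ C₀ * Real.sqrt (L2Sq (m t)))
    (hu3 : ∀ t : ℝ, HNorm 3 (u t) ≤ C₀ * HNorm 1 (m t)) :
    ∃ C > 0, ∀ t : ℝ,
      deriv (fun τ => HSq 1 (m τ) + HSq 2 (ρ τ)) t
        ≤ C * (L2Sq (m t)
            + (1 + Real.sqrt (L2Sq (m t)) + HNorm 1 (ρ t)) * (HSq 1 (m t) + HSq 2 (ρ t))) := by
  change JointlySmooth u at hu
  change JointlySmooth ρ at hρ
  change JointlySmooth m at hm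
  set ux := spaceDeriv u with hux_def
  set uxx := spaceDeriv ux with huxx_def
  set uxxx := spaceDeriv uxx with huxxx_def
  set mx := spaceDeriv m with hmx_def
  set mxx := spaceDeriv mx with hmxx_def
  set ρx := spaceDeriv ρ with hρx_def
  set ρxx := spaceDeriv ρx with hρxx_def
  set ρxxx := spaceDeriv ρxx with hρxxx_def
  have hu₁ : JointlySmooth ux := hu.spaceDeriv
  have hu₂ : JointlySmooth uxx := hu₁.spaceDeriv
  have hu₃ : JointlySmooth uxxx := hu₂.spaceDeriv
  have hm₁ : JointlySmooth mx := hm.spaceDeriv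
  have hρ₁ : JointlySmooth ρx := hρ.spaceDeriv
  have hρ₂ : JointlySmooth ρxx := hρ₁.spaceDeriv
  -- the evolution equations and their spatial derivatives
  have em (t : ℝ) : timeDeriv m t
      = fun x => α * ux t x - a * ux t x * m t x - u t x * mx t x - κ * ρ t x * ρx t x :=
    funext (hmt t)
  have eρ (t : ℝ) : timeDeriv ρ t
      = fun x => -(u t x) * ρx t x - (a - 1) * ux t x * ρ t x :=
    funext (hρt t)
  have em₁ (t x : ℝ) : timeDeriv mx t x
      = α * uxx t x - a * (uxx t x * m t x + ux t x * mx t x)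
        - (ux t x * mx t x + u t x * mxx t x) - κ * (ρx t x * ρx t x + ρ t x * ρxx t x) := by
    rw [hmx_def, hm.timeDeriv_spaceDeriv]
    refine HasDerivAt.deriv ?_
    rw [em]
    convert! ((((hu₁.hasDerivAt_space t x).const_mul α).sub
      (((hu₁.hasDerivAt_space t x).const_mul a).mul (hm.hasDerivAt_space t x))).sub
      ((hu.hasDerivAt_space t x).mul (hm₁.hasDerivAt_space t x))).sub
      (((hρ.hasDerivAt_space t x).const_mul κ).mul (hρ₁.hasDerivAt_space t x)) using 1
    ring
  have eρ₁ (t : ℝ) : timeDeriv ρx t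
      = fun x => -(ux t x * ρx t x + u t x * ρxx t x)
        - (a - 1) * (uxx t x * ρ t x + ux t x * ρx t x) := by
    ext x
    rw [hρx_def, hρ.timeDeriv_spaceDeriv]
    refine HasDerivAt.deriv ?_
    rw [eρ]
    convert! ((hu.hasDerivAt_space t x).neg.mul (hρ₁.hasDerivAt_space t x)).sub
      (((hu₁.hasDerivAt_space t x).const_mul (a - 1)).mul (hρ.hasDerivAt_space t x)) using 1
    simp only [Pi.neg_apply]
    ring
  have eρ₂ (t x : ℝ) : timeDeriv ρxx t x
      = -(uxx t x * ρx t x + 2 * (ux t x * ρxx t x) + u t x * ρxxx t x)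
        - (a - 1) * (uxxx t x * ρ t x + 2 * (uxx t x * ρx t x) + ux t x * ρxx t x) := by
    rw [hρxx_def, hρ₁.timeDeriv_spaceDeriv]
    refine HasDerivAt.deriv ?_
    rw [eρ₁]
    convert! (((hu₁.hasDerivAt_space t x).mul (hρ₁.hasDerivAt_space t x)).add
      ((hu.hasDerivAt_space t x).mul (hρ₂.hasDerivAt_space t x))).neg.sub
      ((((hu₂.hasDerivAt_space t x).mul (hρ.hasDerivAt_space t x)).add
      ((hu₁.hasDerivAt_space t x).mul (hρ₁.hasDerivAt_space t x))).const_mul (a - 1)) using 1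
    ring
  -- the energy `e²`, the low-order norm `L`, and the right-hand side `X`
  have Em (t : ℝ) : HSq 1 (m t) = L2Sq (m t) + L2Sq (mx t) := HSq_one _
  have Eρ₁ (t : ℝ) : HSq 1 (ρ t) = L2Sq (ρ t) + L2Sq (ρx t) := HSq_one _
  have Eρ (t : ℝ) : HSq 2 (ρ t) = HSq 1 (ρ t) + L2Sq (ρxx t) := HSq_two _
  have Eu₁ (t : ℝ) : HSq 1 (u t) = L2Sq (u t) + L2Sq (ux t) := HSq_one _
  have Eu₂ (t : ℝ) : HSq 2 (u t) = HSq 1 (u t) + L2Sq (uxx t) := HSq_two _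
  have Eu₃ (t : ℝ) : HSq 3 (u t) = HSq 2 (u t) + L2Sq (uxxx t) := HSq_three _
  have n0 := L2Sq_nonneg
  set e : ℝ → ℝ := fun t => √(HSq 1 (m t) + HSq 2 (ρ t)) with he_def
  set L : ℝ → ℝ := fun t => √(L2Sq (m t)) + HNorm 1 (ρ t) with hL_def
  set X : ℝ → ℝ := fun t => L2Sq (m t)
    + (1 + √(L2Sq (m t)) + HNorm 1 (ρ t)) * (HSq 1 (m t) + HSq 2 (ρ t)) with hX_def
  have he₀ (t : ℝ) : 0 ≤ e t := Real.sqrt_nonneg _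
  have hL₀ (t : ℝ) : 0 ≤ L t := add_nonneg (Real.sqrt_nonneg _) (Real.sqrt_nonneg _)
  have he (t : ℝ) : e t * e t = HSq 1 (m t) + HSq 2 (ρ t) := by
    refine Real.mul_self_sqrt ?_
    linarith [Em t, Eρ t, Eρ₁ t, n0 (m t), n0 (mx t), n0 (ρ t), n0 (ρx t), n0 (ρxx t)]
  have hXe (t : ℝ) : X t = L2Sq (m t) + (1 + L t) * (e t * e t) := by
    rw [he, hX_def, hL_def]
    ring
  have hee (t : ℝ) : e t * e t ≤ X t := by
    rw [hXe]
    nlinarith [n0 (m t), mul_nonneg (hL₀ t) (mul_self_nonneg (e t))]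
  have hLee (t : ℝ) : L t * e t * e t ≤ X t := by
    rw [hXe]
    nlinarith [n0 (m t), mul_self_nonneg (e t)]
  -- norms controlled by `e`
  have le_e {f : ℝ → ℝ → ℝ} (hf : ∀ t, L2Sq (f t) ≤ HSq 1 (m t) + HSq 2 (ρ t)) :
      L2Controlled e f := ⟨1, fun t => by rw [one_mul]; exact Real.sqrt_le_sqrt (hf t)⟩
  have m_e : L2Controlled e m := le_e fun t => by
    linarith [Em t, Eρ t, Eρ₁ t, n0 (mx t), n0 (ρ t), n0 (ρx t), n0 (ρxx t)]
  have mx_e : L2Controlled e mx := le_e fun t => by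
    linarith [Em t, Eρ t, Eρ₁ t, n0 (m t), n0 (ρ t), n0 (ρx t), n0 (ρxx t)]
  have ρ_e : L2Controlled e ρ := le_e fun t => by
    linarith [Em t, Eρ t, Eρ₁ t, n0 (m t), n0 (mx t), n0 (ρx t), n0 (ρxx t)]
  have ρx_e : L2Controlled e ρx := le_e fun t => by
    linarith [Em t, Eρ t, Eρ₁ t, n0 (m t), n0 (mx t), n0 (ρ t), n0 (ρxx t)]
  have ρxx_e : L2Controlled e ρxx := le_e fun t => by
    linarith [Em t, Eρ t, Eρ₁ t, n0 (m t), n0 (mx t), n0 (ρ t), n0 (ρx t)]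
  have m_sup : SupControlled e m := .of_L2 hm m_e mx_e
  have ρx_sup : SupControlled e ρx := .of_L2 hρ₁ ρx_e ρxx_e
  have hMe (t : ℝ) : √(L2Sq (m t)) ≤ e t := Real.sqrt_le_sqrt <| by
    linarith [Em t, Eρ t, Eρ₁ t, n0 (mx t), n0 (ρ t), n0 (ρx t), n0 (ρxx t)]
  have ML (t : ℝ) : √(L2Sq (m t)) ≤ L t := le_add_of_nonneg_right (Real.sqrt_nonneg _)
  -- norms of the velocity and low-order norms of the density
  have u_M {f : ℝ → ℝ → ℝ} (hf : ∀ t, L2Sq (f t) ≤ HSq 2 (u t)) (t : ℝ) :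
      √(L2Sq (f t)) ≤ C₀ * √(L2Sq (m t)) := (Real.sqrt_le_sqrt (hf t)).trans (hu2 t)
  have u_L {f : ℝ → ℝ → ℝ} (hf : ∀ t, L2Sq (f t) ≤ HSq 2 (u t)) : L2Controlled L f :=
    ⟨C₀, fun t => (u_M hf t).trans (mul_le_mul_of_nonneg_left (ML t) hC₀.le)⟩
  have u_e {f : ℝ → ℝ → ℝ} (hf : ∀ t, L2Sq (f t) ≤ HSq 2 (u t)) : L2Controlled e f :=
    ⟨C₀, fun t => (u_M hf t).trans (mul_le_mul_of_nonneg_left (hMe t) hC₀.le)⟩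
  have ux_le (t : ℝ) : L2Sq (ux t) ≤ HSq 2 (u t) := by
    linarith [Eu₁ t, Eu₂ t, n0 (u t), n0 (uxx t)]
  have uxx_le (t : ℝ) : L2Sq (uxx t) ≤ HSq 2 (u t) := by
    linarith [Eu₁ t, Eu₂ t, n0 (u t), n0 (ux t)]
  have ux_sup : SupControlled L ux := .of_L2 hu₁ (u_L ux_le) (u_L uxx_le)
  have uxxx_e : L2Controlled e uxxx := by
    refine ⟨C₀, fun t => ?_⟩
    calc √(L2Sq (uxxx t)) ≤ HNorm 3 (u t) := Real.sqrt_le_sqrt <| by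
          linarith [Eu₁ t, Eu₂ t, Eu₃ t, n0 (u t), n0 (ux t), n0 (uxx t)]
      _ ≤ C₀ * HNorm 1 (m t) := hu3 t
      _ ≤ C₀ * e t := mul_le_mul_of_nonneg_left (Real.sqrt_le_sqrt <| by
          linarith [Eρ t, Eρ₁ t, n0 (ρ t), n0 (ρx t), n0 (ρxx t)]) hC₀.le
  have ρ_le_L {f : ℝ → ℝ → ℝ} (hf : ∀ t, L2Sq (f t) ≤ HSq 1 (ρ t)) : L2Controlled L f :=
    ⟨1, fun t => by
      rw [one_mul]
      exact (Real.sqrt_le_sqrt (hf t)).trans (le_add_of_nonneg_left (Real.sqrt_nonneg _))⟩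
  have ρx_L : L2Controlled L ρx := ρ_le_L fun t => by linarith [Eρ₁ t, n0 (ρ t)]
  have ρ_sup : SupControlled L ρ :=
    .of_L2 hρ (ρ_le_L fun t => by linarith [Eρ₁ t, n0 (ρx t)]) ρx_L
  -- products controlled by `X`
  have lin {f g : ℝ → ℝ → ℝ} (hf : JointlySmooth f) (hg : JointlySmooth g)
      (hfe : L2Controlled e f) (hge : L2Controlled e g) :
      MeanControlled X (fun t x => f t x * g t x) :=
    (MeanControlled.mul hf hg hfe hge).mono (fun t => mul_self_nonneg _) hee
  have hLee₀ (t : ℝ) : 0 ≤ L t * e t * e t := mul_nonneg (mul_nonneg (hL₀ t) (he₀ t)) (he₀ t)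
  have sup_low {f g h : ℝ → ℝ → ℝ} (hf : JointlySmooth f) (hg : JointlySmooth g)
      (hh : JointlySmooth h) (hfL : SupControlled L f) (hge : L2Controlled e g)
      (hhe : L2Controlled e h) : MeanControlled X (fun t x => f t x * g t x * h t x) :=
    (MeanControlled.mul_mul hf hg hh hfL hge hhe).mono hLee₀ hLee
  have sup_high {f g h : ℝ → ℝ → ℝ} (hf : JointlySmooth f) (hg : JointlySmooth g)
      (hh : JointlySmooth h) (hfe : SupControlled e f) (hgL : L2Controlled L g)
      (hhe : L2Controlled e h) : MeanControlled X (fun t x => f t x * g t x * h t x) :=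
    (MeanControlled.mul_mul hf hg hh hfe hgL hhe).mono
      (fun t => by rw [mul_comm (e t)]; exact hLee₀ t)
      (fun t => by rw [mul_comm (e t)]; exact hLee t)
  have transp {g : ℝ → ℝ → ℝ} (hg : JointlySmooth g) (hgp : ∀ t, Function.Periodic (g t) 1)
      (hge : L2Controlled e g) :
      MeanControlled X (fun t x => u t x * g t x * spaceDeriv g t x) :=
    (MeanControlled.transport hu hg hup hgp ux_sup hge).mono hLee₀ hLee
  -- the five contributions to the time derivative of the energy
  have Im : MeanControlled X (fun t x => 2 * m t x * timeDeriv m t x) := by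
    convert ((((lin hu₁ hm (u_e ux_le) m_e).const_mul (2 * α)).add
      ((sup_low hu₁ hm hm ux_sup m_e m_e).const_mul (-2 * a))).add
      ((transp hm hmp m_e).const_mul (-2))).add
      ((sup_low hρ hm hρ₁ ρ_sup m_e ρx_e).const_mul (-2 * κ)) using 3 with t x
    rw [em]
    ring
  have Imx : MeanControlled X (fun t x => 2 * mx t x * timeDeriv mx t x) := by
    convert (((((lin hu₂ hm₁ (u_e uxx_le) mx_e).const_mul (2 * α)).add
      ((sup_high hm hu₂ hm₁ m_sup (u_L uxx_le) mx_e).const_mul (-2 * a))).add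
      ((sup_low hu₁ hm₁ hm₁ ux_sup mx_e mx_e).const_mul (-2 * (a + 1)))).add
      ((transp hm₁ (periodic_spaceDeriv hmp) mx_e).const_mul (-2))).add
      (((sup_high hρ₁ hρ₁ hm₁ ρx_sup ρx_L mx_e).add
      (sup_low hρ hρ₂ hm₁ ρ_sup ρxx_e mx_e)).const_mul (-2 * κ)) using 3 with t x
    rw [em₁]
    ring
  have Iρ : MeanControlled X (fun t x => 2 * ρ t x * timeDeriv ρ t x) := by
    convert ((transp hρ hρp ρ_e).const_mul (-2)).add
      ((sup_low hu₁ hρ hρ ux_sup ρ_e ρ_e).const_mul (-2 * (a - 1))) using 3 with t x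
    rw [eρ]
    ring
  have Iρx : MeanControlled X (fun t x => 2 * ρx t x * timeDeriv ρx t x) := by
    convert (((transp hρ₁ (periodic_spaceDeriv hρp) ρx_e).const_mul (-2)).add
      ((sup_low hu₁ hρ₁ hρ₁ ux_sup ρx_e ρx_e).const_mul (-2 * a))).add
      ((sup_low hρ hu₂ hρ₁ ρ_sup (u_e uxx_le) ρx_e).const_mul (-2 * (a - 1))) using 3 with t x
    rw [eρ₁]
    ring
  have Iρxx : MeanControlled X (fun t x => 2 * ρxx t x * timeDeriv ρxx t x) := by
    convert (((transp hρ₂ (periodic_spaceDeriv (periodic_spaceDeriv hρp)) ρxx_e).const_mul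
      (-2)).add
      ((sup_low hu₁ hρ₂ hρ₂ ux_sup ρxx_e ρxx_e).const_mul (-2 * (a + 1)))).add
      (((sup_high hρ₁ hu₂ hρ₂ ρx_sup (u_L uxx_le) ρxx_e).const_mul (-2 * (2 * a - 1))).add
      ((sup_low hρ hu₃ hρ₂ ρ_sup uxxx_e ρxx_e).const_mul (-2 * (a - 1)))) using 3 with t x
    rw [eρ₂]
    ring
  obtain ⟨_, c₁, h₁⟩ := Im
  obtain ⟨_, c₂, h₂⟩ := Imx
  obtain ⟨_, c₃, h₃⟩ := Iρ
  obtain ⟨_, c₄, h₄⟩ := Iρx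
  obtain ⟨_, c₅, h₅⟩ := Iρxx
  refine ⟨|c₁ + c₂ + c₃ + c₄ + c₅| + 1, by positivity, fun t => ?_⟩
  have hsplit : (fun τ => HSq 1 (m τ) + HSq 2 (ρ τ)) = fun τ =>
      L2Sq (m τ) + L2Sq (mx τ) + (L2Sq (ρ τ) + L2Sq (ρx τ) + L2Sq (ρxx τ)) := by
    ext τ
    rw [Em, Eρ, Eρ₁]
  have hderiv := ((hm.hasDerivAt_L2Sq t).add (hm₁.hasDerivAt_L2Sq t)).add
    (((hρ.hasDerivAt_L2Sq t).add (hρ₁.hasDerivAt_L2Sq t)).add (hρ₂.hasDerivAt_L2Sq t))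
  rw [hsplit]
  refine (HasDerivAt.deriv hderiv).le.trans ?_
  have hX₀ : 0 ≤ X t := (mul_self_nonneg _).trans (hee t)
  change _ ≤ _ * X t
  have hc := mul_le_mul_of_nonneg_right (le_abs_self (c₁ + c₂ + c₃ + c₄ + c₅)) hX₀
  linarith [(abs_le.1 (h₁ t)).2, (abs_le.1 (h₂ t)).2, (abs_le.1 (h₃ t)).2,
    (abs_le.1 (h₄ t)).2, (abs_le.1 (h₅ t)).2]
end
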